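/- Let α ≥ 0, λ ≥ 0 and k, a, h₀, u_∞ > 0, let ξ > 0, and set C₁ = u_∞·ξ·M(−α/2 + 1/2, 3/2, −ξ²) / D and C₂ = −u_∞·M(−α/2, 1/2, −ξ²) / D, where D = (k/(2·a·h₀))·M(−α/2, 1/2, −ξ²) + λ·ξ·M(−α/2 + 1/2, 3/2, −ξ²). Define u(x,t) = t^{α/2}·[C₁·M(−α/2, 1/2, −η²) + C₂·η·M(−α/2 + 1/2, 3/2, −η²)] with η = x/(2a√t), and s(t) = 2ξa√t. Then for every t > 0 the spatial derivative of u at the free boundary satisfies ∂u/∂x(s(t), t) = −t^{(α−1)/2}·u_∞ / ( 2a·[ (k/(2·a·h₀))·M(α/2 + 1/2, 1/2, ξ²) + λ·ξ·M(α/2 + 1, 3/2, ξ²) ] ). -/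

import Mathlib

/-- Kummer's confluent hypergeometric function
`M(a,b,z) = ∑ (a)_n / (b)_n · zⁿ/n!`, with `(a)_n` the rising factorial. -/
noncomputable def kummerM (a b z : ℝ) : ℝ :=
  ∑' n : ℕ, ((ascPochhammer ℝ n).eval a / (ascPochhammer ℝ n).eval b) * z ^ n / (n.factorial : ℝ)

open Filter Topology Finset

theorem ascPochhammer_succ_eval_left (a : ℝ) (n : ℕ) :
    (ascPochhammer ℝ (n + 1)).eval a = a * (ascPochhammer ℝ n).eval (a + 1) := by
  simp [ascPochhammer_succ_left]

theorem ascPochhammer_eval_ne_zero {b : ℝ} (hb : ∀ n : ℕ, b + n ≠ 0) (n : ℕ) :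
    (ascPochhammer ℝ n).eval b ≠ 0 := by
  induction n with
  | zero => simp
  | succ n ih => rw [ascPochhammer_succ_eval]; exact mul_ne_zero ih (hb n)

theorem add_one_add_natCast_ne_zero {b : ℝ} (hb : ∀ n : ℕ, b + n ≠ 0) (n : ℕ) :
    b + 1 + n ≠ 0 := by
  have h := hb (n + 1)
  push_cast at h
  rwa [add_assoc, add_comm 1 (n : ℝ)]

/-- The `n`-th term of the series defining `kummerM a b z`. -/
noncomputable def kummerTerm (a b z : ℝ) (n : ℕ) : ℝ :=
  ((ascPochhammer ℝ n).eval a / (ascPochhammer ℝ n).eval b) * z ^ n / (n.factorial : ℝ)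

theorem kummerTerm_zero (a b z : ℝ) : kummerTerm a b z 0 = 1 := by
  simp [kummerTerm]

theorem kummerTerm_succ {b : ℝ} (hb : ∀ n : ℕ, b + n ≠ 0) (a z : ℝ) (n : ℕ) :
    kummerTerm a b z (n + 1) = (a + n) / (b + n) * z / (n + 1) * kummerTerm a b z n := by
  have h₁ := ascPochhammer_eval_ne_zero hb n
  have h₂ := hb n
  simp only [kummerTerm, ascPochhammer_succ_eval, Nat.factorial_succ, pow_succ]
  push_cast
  field_simp

theorem kummerTerm_succ' {b : ℝ} (hb : ∀ n : ℕ, b + n ≠ 0) (a z : ℝ) (n : ℕ) :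
    kummerTerm a b z (n + 1) = a / b * z / (n + 1) * kummerTerm (a + 1) (b + 1) z n := by
  have h₁ := ascPochhammer_eval_ne_zero (add_one_add_natCast_ne_zero hb) n
  have h₂ : b ≠ 0 := by simpa using hb 0
  simp only [kummerTerm, ascPochhammer_succ_eval_left, Nat.factorial_succ, pow_succ]
  push_cast
  field_simp

theorem tendsto_kummerTerm_ratio (a b z : ℝ) :
    Tendsto (fun n : ℕ => (a + n) / (b + n) * z / (n + 1)) atTop (𝓝 0) := by
  have h₁ : Tendsto (fun n : ℕ => (a + n) / (b + n)) atTop (𝓝 1) := by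
    simpa using tendsto_add_mul_div_add_mul_atTop_nhds a b (1 : ℝ) one_ne_zero
  have h₂ := (h₁.mul_const z).mul tendsto_one_div_add_atTop_nhds_zero_nat
  simpa [div_eq_mul_inv] using h₂

theorem summable_norm_kummerTerm {b : ℝ} (hb : ∀ n : ℕ, b + n ≠ 0) (a z : ℝ) :
    Summable fun n => ‖kummerTerm a b z n‖ := by
  have h := (tendsto_kummerTerm_ratio a b z).norm
  rw [norm_zero] at h
  refine summable_of_ratio_norm_eventually_le (r := 1 / 2) (by norm_num) ?_
  filter_upwards [h.eventually_le_const (by norm_num : (0 : ℝ) < 1 / 2)] with n hn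
  rw [norm_norm, norm_norm, kummerTerm_succ hb, norm_mul]
  gcongr

theorem summable_kummerTerm {b : ℝ} (hb : ∀ n : ℕ, b + n ≠ 0) (a z : ℝ) :
    Summable (kummerTerm a b z) :=
  (summable_norm_kummerTerm hb a z).of_norm

theorem kummerM_eq_one_add_tsum {b : ℝ} (hb : ∀ n : ℕ, b + n ≠ 0) (a z : ℝ) :
    kummerM a b z = 1 + ∑' n : ℕ, kummerTerm a b z (n + 1) := by
  rw [← kummerTerm_zero a b z]
  exact (summable_kummerTerm hb a z).tsum_eq_zero_add

theorem kummerM_zero {b : ℝ} (hb : ∀ n : ℕ, b + n ≠ 0) (a : ℝ) : kummerM a b 0 = 1 := by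
  rw [kummerM_eq_one_add_tsum hb]
  simp [kummerTerm]

theorem hasDerivAt_kummerM {b : ℝ} (hb : ∀ n : ℕ, b + n ≠ 0) (a z : ℝ) :
    HasDerivAt (kummerM a b) (a / b * kummerM (a + 1) (b + 1) z) z := by
  have hb' := add_one_add_natCast_ne_zero hb
  have hz : z ∈ Metric.ball (0 : ℝ) (|z| + 1) := by simp
  have h := hasDerivAt_tsum_of_isPreconnected
    (g := fun n y => kummerTerm a b y (n + 1))
    (g' := fun n y => a / b * kummerTerm (a + 1) (b + 1) y n)
    (u := fun n => ‖a / b‖ * ‖kummerTerm (a + 1) (b + 1) (|z| + 1) n‖)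
    ((summable_norm_kummerTerm hb' _ _).mul_left _) Metric.isOpen_ball
    (convex_ball (0 : ℝ) (|z| + 1)).isPreconnected
    (fun n y _ => ?_) (fun n y hy => ?_) hz
    ((summable_nat_add_iff 1).2 (summable_kummerTerm hb a z)) hz
  · rw [tsum_mul_left] at h
    exact (h.const_add 1).congr_of_eventuallyEq
      (Eventually.of_forall fun y => kummerM_eq_one_add_tsum hb a y)
  · have h₁ := ((hasDerivAt_pow (n + 1) y).const_mul
      ((ascPochhammer ℝ (n + 1)).eval a / (ascPochhammer ℝ (n + 1)).eval b)).div_const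
      ((n + 1).factorial : ℝ)
    refine h₁.congr_deriv ?_
    have h₂ := ascPochhammer_eval_ne_zero hb' n
    have h₃ : b ≠ 0 := by simpa using hb 0
    simp only [kummerTerm, ascPochhammer_succ_eval_left, Nat.factorial_succ]
    push_cast
    field_simp
  · rw [norm_mul]
    refine mul_le_mul_of_nonneg_left ?_ (norm_nonneg _)
    have hy' : ‖y‖ ≤ ‖|z| + 1‖ := by
      rw [Real.norm_of_nonneg (by positivity : 0 ≤ |z| + 1)]
      simpa using (mem_ball_zero_iff.1 hy).le
    simp only [kummerTerm, norm_div, norm_mul, norm_pow]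
    gcongr

theorem kummerM_add_one_left {b : ℝ} (hb : ∀ n : ℕ, b + n ≠ 0) (a z : ℝ) :
    kummerM (a + 1) b z = kummerM a b z + z / b * kummerM (a + 1) (b + 1) z := by
  have hb' := add_one_add_natCast_ne_zero hb
  have hs := (summable_nat_add_iff 1).2 (summable_kummerTerm hb a z)
  rw [kummerM_eq_one_add_tsum hb, kummerM_eq_one_add_tsum hb a]
  change _ = _ + z / b * ∑' n, kummerTerm (a + 1) (b + 1) z n
  rw [← tsum_mul_left, add_assoc,
    ← hs.tsum_add ((summable_kummerTerm hb' _ _).mul_left _)]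
  congr 2
  ext n
  have h₁ := ascPochhammer_eval_ne_zero hb' n
  have h₂ : b ≠ 0 := by simpa using hb 0
  simp only [kummerTerm]
  rw [ascPochhammer_succ_eval_left b, ascPochhammer_succ_eval_left a, ascPochhammer_succ_eval]
  simp only [Nat.factorial_succ, pow_succ]
  push_cast
  field_simp
  ring

theorem mul_kummerM_eq_add_one_right {b : ℝ} (hb : ∀ n : ℕ, b + n ≠ 0) (a z : ℝ) :
    b * kummerM a b z =
      b * kummerM a (b + 1) z + z * (a / (b + 1)) * kummerM (a + 1) (b + 1 + 1) z := by
  have hb' := add_one_add_natCast_ne_zero hb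
  have hb'' := add_one_add_natCast_ne_zero hb'
  have hs := (summable_nat_add_iff 1).2 (summable_kummerTerm hb' a z)
  rw [kummerM_eq_one_add_tsum hb, kummerM_eq_one_add_tsum hb' a]
  change _ = _ + z * (a / (b + 1)) * ∑' n, kummerTerm (a + 1) (b + 1 + 1) z n
  rw [mul_add, mul_add, add_assoc, ← tsum_mul_left, ← tsum_mul_left, ← tsum_mul_left,
    ← (hs.mul_left b).tsum_add ((summable_kummerTerm hb'' _ _).mul_left _)]
  congr 2
  ext n
  have h₂ : b ≠ 0 := by simpa using hb 0
  have h₃ : b + 1 ≠ 0 := by simpa using hb' 0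
  have h₁ := hb' n
  rw [kummerTerm_succ' hb' a]
  have h₄ : kummerTerm a b z (n + 1) =
      (b + 1 + n) / b * kummerTerm a (b + 1) z (n + 1) := by
    simp only [kummerTerm]
    rw [ascPochhammer_succ_eval_left b, ascPochhammer_succ_eval n (b + 1)]
    field_simp
  rw [h₄, kummerTerm_succ' hb' a]
  field_simp
  ring

/-- Kummer's differential equation, with the derivatives written as contiguous functions. -/
theorem kummerM_differential_equation {b : ℝ} (hb : ∀ n : ℕ, b + n ≠ 0) (a z : ℝ) :
    z * (a / b * ((a + 1) / (b + 1) * kummerM (a + 1 + 1) (b + 1 + 1) z)) =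
      (z - b) * (a / b * kummerM (a + 1) (b + 1) z) + a * kummerM a b z := by
  have h₀ : b ≠ 0 := by simpa using hb 0
  have h₁ := mul_kummerM_eq_add_one_right hb (a + 1) z
  have h₂ := kummerM_add_one_left hb a z
  rw [h₂] at h₁
  have h₃ : z * ((a + 1) / (b + 1)) * kummerM (a + 1 + 1) (b + 1 + 1) z =
      b * (kummerM a b z + z / b * kummerM (a + 1) (b + 1) z)
        - b * kummerM (a + 1) (b + 1) z := by linarith
  calc _ = a / b * (z * ((a + 1) / (b + 1)) * kummerM (a + 1 + 1) (b + 1 + 1) z) := by ring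
    _ = _ := by
      rw [h₃]
      field_simp
      ring

/-- The Wronskian of the solutions `M(a, b, z)` and `z ^ (1 - b) * M(a - b + 1, 2 - b, z)` of
Kummer's equation, with the factor `z ^ (-b)` removed. -/
theorem kummerM_wronskian {b : ℝ} (hb : ∀ n : ℕ, b + n ≠ 0) (hb' : ∀ n : ℕ, 2 - b + n ≠ 0)
    (a z : ℝ) :
    (1 - b) * kummerM a b z * kummerM (a - b + 1) (2 - b) z +
      z * (kummerM a b z *
          ((a - b + 1) / (2 - b) * kummerM (a - b + 1 + 1) (2 - b + 1) z) -
        a / b * kummerM (a + 1) (b + 1) z * kummerM (a - b + 1) (2 - b) z) =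
      (1 - b) * Real.exp z := by
  set W : ℝ → ℝ := fun z => (1 - b) * kummerM a b z * kummerM (a - b + 1) (2 - b) z +
      z * (kummerM a b z *
          ((a - b + 1) / (2 - b) * kummerM (a - b + 1 + 1) (2 - b + 1) z) -
        a / b * kummerM (a + 1) (b + 1) z * kummerM (a - b + 1) (2 - b) z) with hW
  have hW' : ∀ z, HasDerivAt W (W z) z := fun z => by
    have d₁ := hasDerivAt_kummerM hb a z
    have d₂ := hasDerivAt_kummerM hb' (a - b + 1) z
    have e₁ := (hasDerivAt_kummerM (add_one_add_natCast_ne_zero hb) (a + 1) z).const_mul (a / b)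
    have e₂ := (hasDerivAt_kummerM (add_one_add_natCast_ne_zero hb') (a - b + 1 + 1) z).const_mul
      ((a - b + 1) / (2 - b))
    refine (((d₁.const_mul (1 - b)).mul d₂).add
      ((hasDerivAt_id z).mul ((d₁.mul e₂).sub (e₁.mul d₂)))).congr_deriv ?_
    have o₁ := kummerM_differential_equation hb a z
    have o₂ := kummerM_differential_equation hb' (a - b + 1) z
    simp only [hW, id, Pi.mul_apply, Pi.sub_apply]
    linear_combination kummerM a b z * o₂ - kummerM (a - b + 1) (2 - b) z * o₁
  have hd : ∀ z, HasDerivAt (fun z => W z * Real.exp (-z)) 0 z := fun z =>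
    ((hW' z).mul (hasDerivAt_neg z).exp).congr_deriv (by ring)
  have hc := is_const_of_deriv_eq_zero (fun z => (hd z).differentiableAt)
    (fun z => (hd z).deriv) z 0
  have h₀ : W 0 = 1 - b := by simp [hW, kummerM_zero hb, kummerM_zero hb']
  simp only [h₀, neg_zero, Real.exp_zero, mul_one] at hc
  change W z = _
  rw [← hc, mul_assoc, ← Real.exp_add]
  simp

/-- The Chu–Vandermonde identity. -/
theorem sum_range_choose_mul_ascPochhammer_div {b : ℝ} (hb : ∀ n : ℕ, b + n ≠ 0) (a : ℝ)
    (n : ℕ) :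
    ∑ i ∈ range (n + 1), (n.choose i : ℝ) *
      ((-1) ^ i * ((ascPochhammer ℝ i).eval a / (ascPochhammer ℝ i).eval b)) =
      (ascPochhammer ℝ n).eval (b - a) / (ascPochhammer ℝ n).eval b := by
  induction n generalizing a b with
  | zero => simp
  | succ n ih =>
    have hb' := add_one_add_natCast_ne_zero hb
    have h₀ : b ≠ 0 := by simpa using hb 0
    have h₂ := ascPochhammer_eval_ne_zero hb' n
    have h₃ := hb n
    rw [sum_range_succ']
    have key : ∀ i ∈ range (n + 1), ((n + 1).choose (i + 1) : ℝ) *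
        ((-1) ^ (i + 1) * ((ascPochhammer ℝ (i + 1)).eval a / (ascPochhammer ℝ (i + 1)).eval b)) =
        -(a / b) * ((n.choose i : ℝ) * ((-1) ^ i * ((ascPochhammer ℝ i).eval (a + 1) /
          (ascPochhammer ℝ i).eval (b + 1)))) + (n.choose (i + 1) : ℝ) *
        ((-1) ^ (i + 1) * ((ascPochhammer ℝ (i + 1)).eval a /
          (ascPochhammer ℝ (i + 1)).eval b)) := fun i _ => by
      rw [Nat.choose_succ_succ, ascPochhammer_succ_eval_left, ascPochhammer_succ_eval_left,
        mul_div_mul_comm]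
      push_cast
      ring
    rw [sum_congr rfl key, sum_add_distrib, ← mul_sum, ih hb', add_assoc]
    have h₄ := sum_range_succ' (fun i => (n.choose i : ℝ) *
      ((-1) ^ i * ((ascPochhammer ℝ i).eval a / (ascPochhammer ℝ i).eval b))) (n + 1)
    rw [sum_range_succ, ih hb, Nat.choose_succ_self] at h₄
    simp only [Nat.cast_zero, zero_mul, add_zero, Nat.choose_zero_right] at h₄ ⊢
    rw [← h₄, ascPochhammer_succ_eval n (b - a), ascPochhammer_succ_eval_left b,
      add_sub_add_right_eq_sub]
    have h₅ : (ascPochhammer ℝ n).eval b = b * (ascPochhammer ℝ n).eval (b + 1) / (b + n) := by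
      rw [← ascPochhammer_succ_eval_left, ascPochhammer_succ_eval]
      field_simp
    rw [h₅]
    field_simp
    ring

/-- Kummer's transformation. -/
theorem exp_mul_kummerM_neg {b : ℝ} (hb : ∀ n : ℕ, b + n ≠ 0) (a z : ℝ) :
    Real.exp z * kummerM a b (-z) = kummerM (b - a) b z := by
  have he : Real.exp z = ∑' n : ℕ, z ^ n / (n.factorial : ℝ) := by
    rw [Real.exp_eq_exp_ℝ, NormedSpace.exp_eq_tsum_div]
  have hs : Summable fun n : ℕ => ‖z ^ n / (n.factorial : ℝ)‖ :=
    (Real.summable_pow_div_factorial z).norm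
  rw [he, mul_comm]
  change (∑' n, kummerTerm a b (-z) n) * _ = ∑' n, kummerTerm (b - a) b z n
  rw [tsum_mul_tsum_eq_tsum_sum_antidiagonal_of_summable_norm
    (summable_norm_kummerTerm hb a (-z)) hs]
  congr 1
  ext n
  rw [Finset.Nat.sum_antidiagonal_eq_sum_range_succ
    (fun i j => kummerTerm a b (-z) i * (z ^ j / (j.factorial : ℝ))), kummerTerm,
    ← sum_range_choose_mul_ascPochhammer_div hb, sum_mul, sum_div]
  refine sum_congr rfl fun i hi => ?_
  have hi' : i ≤ n := Nat.lt_succ_iff.1 (mem_range.1 hi)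
  have hz : z ^ n = z ^ i * z ^ (n - i) := by rw [← pow_add, Nat.add_sub_cancel' hi']
  rw [Nat.cast_choose ℝ hi', hz, kummerTerm, neg_pow]
  have := Nat.factorial_ne_zero n
  field_simp

/-- For the similarity solution `u` of problem (P) with coefficients `C₁`, `C₂` determined
by `ξ > 0`, the spatial derivative at the free boundary `s(t) = 2ξa√t` equals
`−t^{(α−1)/2}·u_∞ / (2a·[(k/(2ah₀))·M(α/2+1/2,1/2,ξ²) + λξ·M(α/2+1,3/2,ξ²)])`. -/
theorem stmt6 (α lam k a h₀ uinf ξ : ℝ) (hα : 0 ≤ α) (hlam : 0 ≤ lam)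
    (hk : 0 < k) (ha : 0 < a) (hh : 0 < h₀) (huinf : 0 < uinf) (hξ : 0 < ξ)
    (D C₁ C₂ : ℝ)
    (hD : D = (k / (2 * a * h₀)) * kummerM (-α/2) (1/2) (-ξ^2) +
      lam * ξ * kummerM (-α/2 + 1/2) (3/2) (-ξ^2))
    (hC₁ : C₁ = uinf * ξ * kummerM (-α/2 + 1/2) (3/2) (-ξ^2) / D)
    (hC₂ : C₂ = -uinf * kummerM (-α/2) (1/2) (-ξ^2) / D)
    (u : ℝ → ℝ → ℝ)
    (hu : u = fun x t => t ^ (α/2) *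
      (C₁ * kummerM (-α/2) (1/2) (-(x / (2 * a * Real.sqrt t))^2) +
       C₂ * (x / (2 * a * Real.sqrt t)) *
         kummerM (-α/2 + 1/2) (3/2) (-(x / (2 * a * Real.sqrt t))^2)))
    (s : ℝ → ℝ) (hs : s = fun t => 2 * ξ * a * Real.sqrt t) :
    ∀ t : ℝ, 0 < t →
      deriv (fun x => u x t) (s t) =
        -(t ^ ((α - 1)/2)) * uinf /
          (2 * a * ((k / (2 * a * h₀)) * kummerM (α/2 + 1/2) (1/2) (ξ^2) +
            lam * ξ * kummerM (α/2 + 1) (3/2) (ξ^2))) := by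
  intro t ht
  have hb₁ : ∀ n : ℕ, (1 / 2 : ℝ) + n ≠ 0 := fun n => by positivity
  have hb₃ : ∀ n : ℕ, (3 / 2 : ℝ) + n ≠ 0 := fun n => by positivity
  have hst : 0 < Real.sqrt t := Real.sqrt_pos.2 ht
  have hη : s t / (2 * a * Real.sqrt t) = ξ := by
    rw [hs]
    field_simp
  have k₁ := exp_mul_kummerM_neg hb₁ (-α / 2) (ξ ^ 2)
  have k₂ := exp_mul_kummerM_neg hb₃ (-α / 2 + 1 / 2) (ξ ^ 2)
  rw [show 1 / 2 - -α / 2 = α / 2 + 1 / 2 by ring] at k₁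
  rw [show 3 / 2 - (-α / 2 + 1 / 2) = α / 2 + 1 by ring] at k₂
  have hw := kummerM_wronskian hb₁ (fun n => by norm_num; positivity) (-α / 2) (-ξ ^ 2)
  rw [show -α / 2 - 1 / 2 + 1 = -α / 2 + 1 / 2 by ring,
    show (2 : ℝ) - 1 / 2 = 3 / 2 by norm_num] at hw
  have hη' : HasDerivAt (fun x : ℝ => x / (2 * a * Real.sqrt t)) (1 / (2 * a * Real.sqrt t))
      (s t) := (hasDerivAt_id _).div_const _
  have hz := (hη'.pow 2).neg
  have d₁ := (hasDerivAt_kummerM hb₁ (-α / 2)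
    (-(s t / (2 * a * Real.sqrt t)) ^ 2)).comp (s t) hz
  have d₂ := (hasDerivAt_kummerM hb₃ (-α / 2 + 1 / 2)
    (-(s t / (2 * a * Real.sqrt t)) ^ 2)).comp (s t) hz
  have d := (((d₁.const_mul C₁).add ((hη'.const_mul C₂).mul d₂)).const_mul (t ^ (α / 2)))
  rw [hu]
  refine d.deriv.trans ?_
  simp only [Function.comp_apply, Pi.neg_apply, Pi.pow_apply, hη]
  have hpow : t ^ ((α - 1) / 2) = t ^ (α / 2) / Real.sqrt t := by
    rw [Real.sqrt_eq_rpow, ← Real.rpow_sub ht]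
    congr 1
    ring
  have hexp : Real.exp (ξ ^ 2) * Real.exp (-ξ ^ 2) = 1 := by
    rw [← Real.exp_add]
    simp
  have hDE : k / (2 * a * h₀) * kummerM (α / 2 + 1 / 2) (1 / 2) (ξ ^ 2) +
      lam * ξ * kummerM (α / 2 + 1) (3 / 2) (ξ ^ 2) = Real.exp (ξ ^ 2) * D := by
    rw [← k₁, ← k₂, hD]
    ring
  rw [hDE, hpow, hC₁, hC₂]
  have hE : Real.exp (-ξ ^ 2) = (Real.exp (ξ ^ 2))⁻¹ := eq_inv_of_mul_eq_one_right hexp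
  rw [hE] at hw
  generalize t ^ (α / 2) = T
  generalize Real.exp (ξ ^ 2) = E at hw ⊢
  generalize kummerM (-α / 2) (1 / 2) (-ξ ^ 2) = F at hw ⊢
  generalize kummerM (-α / 2 + 1 / 2) (3 / 2) (-ξ ^ 2) = G at hw ⊢
  generalize kummerM (-α / 2 + 1) (1 / 2 + 1) (-ξ ^ 2) = F' at hw ⊢
  generalize kummerM (-α / 2 + 1 / 2 + 1) (3 / 2 + 1) (-ξ ^ 2) = G' at hw ⊢
  push_cast
  simp only [div_eq_mul_inv, mul_inv] at hw ⊢
  linear_combination (-T * a⁻¹ * (Real.sqrt t)⁻¹ * uinf * D⁻¹) * hw
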